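/- Let Ω ⊂ ℝⁿ be a domain and λ > 0. If f is a bounded measurable function on Ω satisfying lim_{t→0⁺} ω_Ω(f,t) = 0, then there exist bounded Lipschitz functions g_j on Ω with dist(supp g_j, ∂Ω) > 0 such that ‖f − g_j‖_{bmo_λ(Ω)} → 0. -/

import Mathlib

open MeasureTheory Metric Filter Topology

noncomputable section

/-- A closed axis-parallel cube in ℝⁿ: a closed ball in the sup norm with
positive radius (`half` = half the sidelength). -/
structure Cube (n : ℕ) where
  center : Fin n → ℝ
  half : ℝ
  half_pos : 0 < half

namespace Cube

variable {n : ℕ}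

/-- The underlying set of a cube. -/
def toSet (Q : Cube n) : Set (Fin n → ℝ) := Metric.closedBall Q.center Q.half

/-- The sidelength ℓ(Q). -/
def side (Q : Cube n) : ℝ := 2 * Q.half

/-- The mean f_Q of f over Q. -/
def avg (Q : Cube n) (f : (Fin n → ℝ) → ℝ) : ℝ := ⨍ x in Q.toSet, f x

/-- Mean oscillation of f over Q. -/
def osc (Q : Cube n) (f : (Fin n → ℝ) → ℝ) : ℝ := ⨍ x in Q.toSet, |f x - Q.avg f|

/-- The mean |f|_Q of |f| over Q. -/
def avgAbs (Q : Cube n) (f : (Fin n → ℝ) → ℝ) : ℝ := ⨍ x in Q.toSet, |f x|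

/-- Distance from the cube to the origin. -/
def distToOrigin (Q : Cube n) : ℝ := Metric.infDist (0 : Fin n → ℝ) Q.toSet

/-- The cube 2Q, concentric with Q and of twice the sidelength. -/
def double (Q : Cube n) : Cube n := ⟨Q.center, 2 * Q.half, mul_pos two_pos Q.half_pos⟩

end Cube

variable {n : ℕ}

/-- The modulus of mean oscillation ω_U(f,t): the supremum of the mean oscillation
of f over cubes Q ⊆ U of sidelength < t. -/
def omegaOn (U : Set (Fin n → ℝ)) (f : (Fin n → ℝ) → ℝ) (t : ℝ) : ℝ :=
  sSup {r | ∃ Q : Cube n, Q.toSet ⊆ U ∧ Q.side < t ∧ r = Q.osc f}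

/-- sup{ |f|_Q : Q ⊆ U, ℓ(Q) ≥ lam }. -/
def bigAvgSup (U : Set (Fin n → ℝ)) (lam : ℝ) (f : (Fin n → ℝ) → ℝ) : ℝ :=
  sSup {r | ∃ Q : Cube n, Q.toSet ⊆ U ∧ lam ≤ Q.side ∧ r = Q.avgAbs f}

/-- The nonhomogeneous norm ‖f‖_{bmo_lam(U)}. -/
def bmoNorm (U : Set (Fin n → ℝ)) (lam : ℝ) (f : (Fin n → ℝ) → ℝ) : ℝ :=
  omegaOn U f lam + bigAvgSup U lam f

/-- Membership in bmo_lam(U): integrable on every cube in U and finite norm. -/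
def MemBmo (U : Set (Fin n → ℝ)) (lam : ℝ) (f : (Fin n → ℝ) → ℝ) : Prop :=
  (∀ Q : Cube n, Q.toSet ⊆ U → IntegrableOn f Q.toSet) ∧
  BddAbove {r | ∃ Q : Cube n, Q.toSet ⊆ U ∧ Q.side < lam ∧ r = Q.osc f} ∧
  BddAbove {r | ∃ Q : Cube n, Q.toSet ⊆ U ∧ lam ≤ Q.side ∧ r = Q.avgAbs f}

/-- Sarason's vanishing mean oscillation condition: ω_U(f,t) → 0 as t → 0⁺. -/
def VanishSmallOsc (U : Set (Fin n → ℝ)) (f : (Fin n → ℝ) → ℝ) : Prop :=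
  Tendsto (fun t => omegaOn U f t) (nhdsWithin 0 (Set.Ioi 0)) (nhds 0)

/-- f is bounded on U. -/
def BoundedOn (U : Set (Fin n → ℝ)) (f : (Fin n → ℝ) → ℝ) : Prop :=
  ∃ M : ℝ, ∀ x ∈ U, |f x| ≤ M

/-- f is Lipschitz on U. -/
def LipschitzOn (U : Set (Fin n → ℝ)) (f : (Fin n → ℝ) → ℝ) : Prop :=
  ∃ K : NNReal, LipschitzOnWith K f U

/-- dist(supp f, ∂U) > 0. -/
def SuppAway (U : Set (Fin n → ℝ)) (f : (Fin n → ℝ) → ℝ) : Prop :=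
  ∃ d > 0, ∀ x ∈ Function.support f, ∀ y ∈ frontier U, d ≤ dist x y

/-- The nonhomogeneous Lipschitz norm ‖f‖_{Lip_b(U)} = ‖f‖_∞ + Lipschitz seminorm. -/
def lipbNorm (U : Set (Fin n → ℝ)) (f : (Fin n → ℝ) → ℝ) : ℝ :=
  sSup {r | ∃ x ∈ U, r = |f x|} +
  sSup {r | ∃ x ∈ U, ∃ y ∈ U, x ≠ y ∧ r = |f x - f y| / dist x y}

/-- U is a domain: a nonempty open connected subset of ℝⁿ. -/
def IsRealDomain (U : Set (Fin n → ℝ)) : Prop := IsOpen U ∧ IsConnected U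

/-- U is an (ε,δ)-domain. -/
def IsEpsDeltaDomain (U : Set (Fin n → ℝ)) (ε δ : ℝ) : Prop :=
  ∀ x ∈ U, ∀ y ∈ U, dist x y < δ →
    ∃ γ : ℝ → (Fin n → ℝ), ContinuousOn γ (Set.Icc 0 1) ∧ γ 0 = x ∧ γ 1 = y ∧
      (∀ t ∈ Set.Icc (0:ℝ) 1, γ t ∈ U) ∧
      eVariationOn γ (Set.Icc 0 1) ≤ ENNReal.ofReal (ε⁻¹ * dist x y) ∧
      ∀ t ∈ Set.Icc (0:ℝ) 1,
        ε * (dist (γ t) x * dist (γ t) y) / dist x y ≤ Metric.infDist (γ t) (frontier U)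

/-- The natural scale λ_{ε,δ} for an (ε,δ)-domain. -/
def lamED (n : ℕ) (ε δ : ℝ) : ℝ := ε ^ 2 * δ / (320 * n * (1 + Real.sqrt n * ε))

/-- d_Ω(x) = dist(x,∂Ω). -/
def distBd (U : Set (Fin n → ℝ)) (x : Fin n → ℝ) : ℝ := Metric.infDist x (frontier U)

/-- Ω̊_t = {x ∈ Ω : d_Ω(x) ≥ t}. -/
def innerPart (U : Set (Fin n → ℝ)) (t : ℝ) : Set (Fin n → ℝ) :=
  {x ∈ U | t ≤ distBd U x}

/-- f vanishes at infinity in the bmo_lam(U) sense. -/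
def VanishAtInfinity (U : Set (Fin n → ℝ)) (lam : ℝ) (f : (Fin n → ℝ) → ℝ) : Prop :=
  Tendsto (fun R => bmoNorm (U \ Metric.closedBall 0 R) lam f) atTop (nhds 0)

/-- f vanishes at the boundary in the bmo_lam(U) sense. -/
def VanishAtBoundary (U : Set (Fin n → ℝ)) (lam : ℝ) (f : (Fin n → ℝ) → ℝ) : Prop :=
  Tendsto (fun t => bmoNorm (U \ innerPart U t) lam f) (nhdsWithin 0 (Set.Ioi 0)) (nhds 0)

/-- f is in the bmo_lam(U)-closure of the continuous functions with compact support in U. -/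
def InCmoClosure (U : Set (Fin n → ℝ)) (lam : ℝ) (f : (Fin n → ℝ) → ℝ) : Prop :=
  ∃ g : ℕ → (Fin n → ℝ) → ℝ,
    (∀ j, Continuous (g j) ∧ HasCompactSupport (g j) ∧ tsupport (g j) ⊆ U) ∧
    Tendsto (fun j => bmoNorm U lam (f - g j)) atTop (nhds 0)

/-- The homogeneous BMO(ℝⁿ) seminorm: sup of mean oscillation over all cubes. -/
def bmoHNorm (f : (Fin n → ℝ) → ℝ) : ℝ := sSup {r | ∃ Q : Cube n, r = Q.osc f}

namespace Cube

/-- The uniform probability measure on a cube. -/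
def unif (Q : Cube n) : Measure (Fin n → ℝ) :=
  (volume.restrict Q.toSet Set.univ)⁻¹ • volume.restrict Q.toSet

lemma volume_toSet (Q : Cube n) : volume Q.toSet = ENNReal.ofReal ((2 * Q.half) ^ n) := by
  simpa [toSet] using Real.volume_pi_closedBall Q.center Q.half_pos.le

lemma side_pow_pos (Q : Cube n) : 0 < (2 * Q.half) ^ n := by
  have := Q.half_pos
  positivity

lemma measurableSet_toSet (Q : Cube n) : MeasurableSet Q.toSet :=
  isClosed_closedBall.measurableSet

instance (Q : Cube n) : IsProbabilityMeasure Q.unif := by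
  constructor
  have := Q.side_pow_pos
  simp only [unif, Measure.smul_apply, Measure.restrict_apply_univ, smul_eq_mul, volume_toSet]
  exact ENNReal.inv_mul_cancel (by simpa using this) ENNReal.ofReal_ne_top

lemma integral_unif (Q : Cube n) (h : (Fin n → ℝ) → ℝ) :
    ∫ x, h x ∂Q.unif = ((2 * Q.half) ^ n)⁻¹ * ∫ x in Q.toSet, h x := by
  have := Q.side_pow_pos
  rw [unif, integral_smul_measure, Measure.restrict_apply_univ, volume_toSet, smul_eq_mul,
    ENNReal.toReal_inv, ENNReal.toReal_ofReal this.le]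

lemma ae_unif (Q : Cube n) {p : (Fin n → ℝ) → Prop} (h : ∀ x ∈ Q.toSet, p x) :
    ∀ᵐ x ∂Q.unif, p x :=
  Measure.ae_smul_measure (ae_restrict_of_forall_mem Q.measurableSet_toSet h) _

lemma integrable_unif (Q : Cube n) {h : (Fin n → ℝ) → ℝ} (hm : Measurable h) {M : ℝ}
    (hM : ∀ x ∈ Q.toSet, |h x| ≤ M) : Integrable h Q.unif :=
  Integrable.of_bound hm.aestronglyMeasurable M (Q.ae_unif hM)

lemma integral_unif_mono (Q : Cube n) {h k : (Fin n → ℝ) → ℝ} (hh : Integrable h Q.unif)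
    (hk : Integrable k Q.unif) (hle : ∀ x ∈ Q.toSet, h x ≤ k x) :
    ∫ x, h x ∂Q.unif ≤ ∫ x, k x ∂Q.unif :=
  integral_mono_ae hh hk (Q.ae_unif hle)

lemma integral_unif_le_const (Q : Cube n) {h : (Fin n → ℝ) → ℝ} {C : ℝ}
    (hh : Integrable h Q.unif) (hle : ∀ x ∈ Q.toSet, h x ≤ C) :
    ∫ x, h x ∂Q.unif ≤ C := by
  simpa using Q.integral_unif_mono hh (integrable_const C) hle

lemma abs_avg_sub_le (Q : Cube n) {h : (Fin n → ℝ) → ℝ} (hh : Integrable h Q.unif) (a : ℝ) :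
    |Q.avg h - a| ≤ ∫ x, |h x - a| ∂Q.unif := by
  have h1 : Q.avg h - a = ∫ x, (h x - a) ∂Q.unif := by
    rw [integral_sub hh (integrable_const a)]
    simp only [integral_const, probReal_univ, one_smul]
    rfl
  rw [h1]
  exact abs_integral_le_integral_abs

lemma osc_le (Q : Cube n) {h : (Fin n → ℝ) → ℝ} (hh : Integrable h Q.unif) (a : ℝ) :
    Q.osc h ≤ 2 * ∫ x, |h x - a| ∂Q.unif := by
  have h1 := Q.abs_avg_sub_le hh a
  have h2 : Integrable (fun x => |h x - a|) Q.unif := (hh.sub (integrable_const a)).abs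
  have h3 : Q.osc h ≤ ∫ x, (|h x - a| + |Q.avg h - a|) ∂Q.unif := by
    refine Q.integral_unif_mono (hh.sub (integrable_const _)).abs
      (h2.add (integrable_const _)) fun x _ => ?_
    have := abs_sub_le (h x) a (Q.avg h)
    rwa [abs_sub_comm a] at this
  rw [integral_add h2 (integrable_const _)] at h3
  simp at h3
  linarith

lemma integral_unif_le_of_subset {Q T : Cube n} (hQT : Q.toSet ⊆ T.toSet)
    {h : (Fin n → ℝ) → ℝ} (hh : IntegrableOn h T.toSet) (h0 : ∀ x, 0 ≤ h x) :
    ∫ x, h x ∂Q.unif ≤ (T.half / Q.half) ^ n * ∫ x, h x ∂T.unif := by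
  have hQ := Q.half_pos
  have hT := T.half_pos
  rw [integral_unif, integral_unif]
  have h1 : ∫ x in Q.toSet, h x ≤ ∫ x in T.toSet, h x :=
    setIntegral_mono_set hh (ae_of_all _ h0) hQT.eventuallyLE
  have h2 : (T.half / Q.half) ^ n * (((2 * T.half) ^ n)⁻¹ * ∫ x in T.toSet, h x) =
      ((2 * Q.half) ^ n)⁻¹ * ∫ x in T.toSet, h x := by
    rw [div_pow, mul_pow, mul_pow]
    field_simp
  rw [h2]
  gcongr

/-- The outer shell of relative width `κ` occupies at most the fraction `n κ` of a ball. -/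
lemma volume_shell_le (x : Fin n → ℝ) {r κ : ℝ} (hr : 0 < r) (h0 : 0 ≤ κ) (h1 : κ ≤ 1) :
    volume.real (closedBall x r \ closedBall x ((1 - κ) * r)) ≤ n * κ * (2 * r) ^ n := by
  have hv : ∀ t : ℝ, 0 ≤ t → volume.real (closedBall x t) = (2 * t) ^ n := by
    intro t ht
    rw [Measure.real, Real.volume_pi_closedBall x ht, ENNReal.toReal_ofReal (by positivity)]
    simp
  have hnn : 0 ≤ (1 - κ) * r := mul_nonneg (by linarith) hr.le
  rw [measureReal_sdiff (closedBall_subset_closedBall (by nlinarith))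
    isClosed_closedBall.measurableSet measure_closedBall_lt_top.ne, hv r hr.le, hv _ hnn]
  have h2 := one_add_mul_le_pow (a := -κ) (by linarith) n
  have h3 : (2 * ((1 - κ) * r)) ^ n = (1 + -κ) ^ n * (2 * r) ^ n := by
    rw [← mul_pow]; ring
  rw [h3]
  have : 0 < (2 * r) ^ n := by positivity
  nlinarith

/-- A function which is small on a slightly shrunk cube and bounded has small mean. -/
lemma integral_unif_le_of_shell (Q : Cube n) {h : (Fin n → ℝ) → ℝ} (hm : Measurable h)
    {κ δ : ℝ} (hκ : 0 ≤ κ) (hκ1 : κ ≤ 1) (hδ : 0 ≤ δ) (h0 : ∀ x, 0 ≤ h x) (h1 : ∀ x, h x ≤ 1)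
    (hin : ∀ x ∈ closedBall Q.center ((1 - κ) * Q.half), h x ≤ δ) :
    ∫ x, h x ∂Q.unif ≤ δ + n * κ := by
  have hp := Q.side_pow_pos
  set S := Q.toSet \ closedBall Q.center ((1 - κ) * Q.half)
  have hSm : MeasurableSet S := Q.measurableSet_toSet.diff isClosed_closedBall.measurableSet
  have hi : Integrable h Q.unif :=
    Q.integrable_unif hm (M := 1) fun x _ => abs_le.2 ⟨by linarith [h0 x], h1 x⟩
  have hind : Integrable (S.indicator (fun _ => (1 : ℝ))) Q.unif :=
    (integrable_const 1).indicator hSm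
  calc ∫ x, h x ∂Q.unif ≤ ∫ x, (δ + S.indicator (fun _ => (1 : ℝ)) x) ∂Q.unif := by
        refine Q.integral_unif_mono hi ((integrable_const δ).add hind) fun x hx => ?_
        by_cases hxS : x ∈ S
        · simpa [hxS] using (h1 x).trans (by linarith)
        · have : x ∈ closedBall Q.center ((1 - κ) * Q.half) := by
            by_contra hc
            exact hxS ⟨hx, hc⟩
          simpa [hxS] using hin x this
    _ = δ + ((2 * Q.half) ^ n)⁻¹ * volume.real S := by
        rw [integral_add (integrable_const δ) hind, integral_unif _ (S.indicator _),
          setIntegral_indicator hSm, Set.inter_eq_right.2 Set.sdiff_subset,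
          setIntegral_const, smul_eq_mul, mul_one, integral_const, probReal_univ, one_smul]
    _ ≤ δ + n * κ := by
        have := volume_shell_le Q.center Q.half_pos hκ hκ1
        refine add_le_add le_rfl ?_
        rw [inv_mul_le_iff₀ hp]
        calc volume.real S ≤ _ := this
          _ = _ := by ring

end Cube

/-- A bound for the integrals over all balls of radius `s` gives a bound on larger balls. -/
lemma setLIntegral_closedBall_mul_le {k : (Fin n → ℝ) → ENNReal} (hk : Measurable k) {s : ℝ}
    {E : ENNReal} (hE : ∀ c, ∫⁻ x in closedBall c s, k x ≤ E) (c₀ : Fin n → ℝ) (R : ℝ) :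
    (∫⁻ x in closedBall c₀ R, k x) * volume (closedBall (0 : Fin n → ℝ) s) ≤
      E * volume (closedBall c₀ (R + s)) := by
  have hset : MeasurableSet {p : (Fin n → ℝ) × (Fin n → ℝ) | dist p.1 p.2 ≤ s} :=
    (isClosed_le (continuous_fst.dist continuous_snd) continuous_const).measurableSet
  let G : (Fin n → ℝ) × (Fin n → ℝ) → ENNReal :=
    {p : (Fin n → ℝ) × (Fin n → ℝ) | dist p.1 p.2 ≤ s}.indicator (fun p => k p.1)
  have hG : Measurable G := (hk.comp measurable_fst).indicator hset
  have hfst : ∀ x, ∫⁻ c, G (x, c) = k x * volume (closedBall (0 : Fin n → ℝ) s) := by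
    intro x
    have : ∀ c, G (x, c) = (closedBall x s).indicator (fun _ => k x) c := by
      intro c
      simp [G, Set.indicator, dist_comm x c]
    simp_rw [this]
    rw [lintegral_indicator isClosed_closedBall.measurableSet, setLIntegral_const,
      Measure.addHaar_closedBall_center]
  have hsnd : ∀ c, ∫⁻ x in closedBall c₀ R, G (x, c) ≤
      (closedBall c₀ (R + s)).indicator (fun _ => E) c := by
    intro c
    by_cases hc : c ∈ closedBall c₀ (R + s)
    · rw [Set.indicator_of_mem hc]
      refine le_trans ?_ (hE c)
      refine (setLIntegral_le_lintegral _ _).trans ?_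
      rw [← lintegral_indicator isClosed_closedBall.measurableSet]
      refine lintegral_mono fun x => ?_
      simp [G, Set.indicator]
    · rw [Set.indicator_of_notMem hc]
      refine le_of_eq ?_
      rw [setLIntegral_congr_fun (g := fun _ => 0) isClosed_closedBall.measurableSet,
        lintegral_zero]
      intro x hx
      refine Set.indicator_of_notMem ?_ _
      intro h
      refine hc (mem_closedBall.2 ?_)
      have h1 : dist x c ≤ s := h
      have h2 := mem_closedBall.1 hx
      have := dist_triangle c x c₀
      rw [dist_comm c x] at this
      linarith
  calc (∫⁻ x in closedBall c₀ R, k x) * volume (closedBall (0 : Fin n → ℝ) s)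
      = ∫⁻ x in closedBall c₀ R, ∫⁻ c, G (x, c) := by
        simp_rw [hfst]
        rw [lintegral_mul_const _ hk]
    _ = ∫⁻ c, ∫⁻ x in closedBall c₀ R, G (x, c) :=
        lintegral_lintegral_swap hG.aemeasurable
    _ ≤ ∫⁻ c, (closedBall c₀ (R + s)).indicator (fun _ => E) c := lintegral_mono hsnd
    _ = E * volume (closedBall c₀ (R + s)) := by
        rw [lintegral_indicator isClosed_closedBall.measurableSet, setLIntegral_const]

/-- If the means of `h ≥ 0` over cubes of half-side `s` are at most `η`, then the means over
larger cubes are at most `2 ^ n * η`. -/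
lemma Cube.integral_unif_le_of_small (Q : Cube n) {h : (Fin n → ℝ) → ℝ} (hm : Measurable h)
    {M : ℝ} (h0 : ∀ x, 0 ≤ h x) (hM : ∀ x, h x ≤ M) {s η : ℝ} (hs : 0 < s) (hsQ : s ≤ Q.half)
    (hη : 0 ≤ η) (hE : ∀ c, ∫ x, h x ∂(⟨c, s, hs⟩ : Cube n).unif ≤ η) :
    ∫ x, h x ∂Q.unif ≤ 2 ^ n * η := by
  have hQ := Q.half_pos
  have hint : ∀ c r, IntegrableOn h (closedBall c r) := fun c r =>
    Measure.integrableOn_of_bounded measure_closedBall_lt_top.ne hm.aestronglyMeasurable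
      (M := M) (ae_of_all _ fun x => by simpa [abs_of_nonneg (h0 x)] using hM x)
  have hof : ∀ c r, ∫⁻ x in closedBall c r, ENNReal.ofReal (h x) =
      ENNReal.ofReal (∫ x in closedBall c r, h x) := fun c r =>
    (ofReal_integral_eq_lintegral_ofReal (hint c r) (ae_of_all _ h0)).symm
  have hball : ∀ c, ∫⁻ x in closedBall c s, ENNReal.ofReal (h x) ≤
      ENNReal.ofReal ((2 * s) ^ n * η) := by
    intro c
    rw [hof]
    refine ENNReal.ofReal_le_ofReal ?_
    have := hE c
    rwa [integral_unif, inv_mul_le_iff₀ (by positivity)] at this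
  have key := setLIntegral_closedBall_mul_le hm.ennreal_ofReal hball Q.center Q.half
  have hnn : 0 ≤ ∫ x in closedBall Q.center Q.half, h x := integral_nonneg h0
  rw [hof, Real.volume_pi_closedBall _ hs.le, Real.volume_pi_closedBall _ (by linarith),
    ← ENNReal.ofReal_mul hnn, ← ENNReal.ofReal_mul (by positivity),
    ENNReal.ofReal_le_ofReal_iff (by positivity), Fintype.card_fin] at key
  have hsn : 0 < (2 * s) ^ n := by positivity
  have key2 : ∫ x in closedBall Q.center Q.half, h x ≤ η * (2 * (Q.half + s)) ^ n := by
    refine le_of_mul_le_mul_right (key.trans (le_of_eq (by ring))) hsn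
  rw [integral_unif, inv_mul_le_iff₀ Q.side_pow_pos]
  calc ∫ x in Q.toSet, h x ≤ η * (2 * (Q.half + s)) ^ n := key2
    _ ≤ η * (2 * (2 * Q.half)) ^ n := by gcongr; linarith
    _ = _ := by rw [mul_pow 2 (2 * Q.half)]; ring

/-- The mean of `F` over the ball of radius `s` around `x`. -/
def ballMean (F : (Fin n → ℝ) → ℝ) (s : ℝ) (x : Fin n → ℝ) : ℝ := ⨍ y in closedBall x s, F y

lemma abs_ballMean_le {F : (Fin n → ℝ) → ℝ} (hm : Measurable F) {M : ℝ} (hM : ∀ x, |F x| ≤ M)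
    {s : ℝ} (hs : 0 < s) (x : Fin n → ℝ) : |ballMean F s x| ≤ M := by
  let Q : Cube n := ⟨x, s, hs⟩
  have hF : Integrable F Q.unif := Q.integrable_unif hm fun x _ => hM x
  have h1 := Q.abs_avg_sub_le hF 0
  simp only [sub_zero] at h1
  exact h1.trans (Q.integral_unif_le_const hF.abs fun x _ => hM x)

lemma abs_setIntegral_diff_closedBall_le {F : (Fin n → ℝ) → ℝ} {M : ℝ}
    (hM : ∀ x, |F x| ≤ M) {s : ℝ} (hs : 0 < s) {x y : Fin n → ℝ} (hxy : dist x y ≤ s) :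
    |∫ z in closedBall x s \ closedBall y s, F z| ≤ M * (n * (dist x y / s) * (2 * s) ^ n) := by
  have hM0 : 0 ≤ M := (abs_nonneg _).trans (hM 0)
  have hfin : volume (closedBall x s \ closedBall y s) < ⊤ :=
    (measure_mono Set.sdiff_subset).trans_lt measure_closedBall_lt_top
  have h1 : |∫ z in closedBall x s \ closedBall y s, F z| ≤
      M * volume.real (closedBall x s \ closedBall y s) := by
    rw [← Real.norm_eq_abs]
    exact norm_setIntegral_le_of_norm_le_const hfin fun z _ => hM z
  refine h1.trans (mul_le_mul_of_nonneg_left ?_ hM0)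
  refine le_trans ?_ (Cube.volume_shell_le x hs (κ := dist x y / s) (by positivity)
    (by rwa [div_le_one hs]))
  refine measureReal_mono ?_ ?_
  · refine Set.sdiff_subset_sdiff_right (closedBall_subset_closedBall' ?_)
    have : (1 - dist x y / s) * s = s - dist x y := by field_simp
    linarith
  · exact ((measure_mono Set.sdiff_subset).trans_lt measure_closedBall_lt_top).ne

lemma exists_lipschitzWith_ballMean (hn : 0 < n) {F : (Fin n → ℝ) → ℝ} (hm : Measurable F)
    {M : ℝ} (hM : ∀ x, |F x| ≤ M) {s : ℝ} (hs : 0 < s) :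
    ∃ K, LipschitzWith K (ballMean F s) := by
  have hM0 : 0 ≤ M := (abs_nonneg _).trans (hM 0)
  refine ⟨Real.toNNReal (2 * M * n / s), LipschitzWith.of_dist_le' fun x y => ?_⟩
  rw [Real.dist_eq]
  have hn1 : (1 : ℝ) ≤ n := by exact_mod_cast hn
  rcases le_total (dist x y) s with hxy | hxy
  · have hint : ∀ c, IntegrableOn F (closedBall c s) := fun c =>
      Measure.integrableOn_of_bounded measure_closedBall_lt_top.ne hm.aestronglyMeasurable
        (M := M) (ae_of_all _ hM)
    have hmean : ∀ c, ballMean F s c = ((2 * s) ^ n)⁻¹ * ∫ z in closedBall c s, F z := fun c =>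
      Cube.integral_unif ⟨c, s, hs⟩ F
    have hx := integral_inter_add_sdiff
      (isClosed_closedBall (x := y) (ε := s)).measurableSet (hint x)
    have hy := integral_inter_add_sdiff
      (isClosed_closedBall (x := x) (ε := s)).measurableSet (hint y)
    rw [Set.inter_comm] at hy
    have h1 := abs_setIntegral_diff_closedBall_le hM hs hxy
    have h2 := abs_setIntegral_diff_closedBall_le hM hs (dist_comm x y ▸ hxy)
    rw [dist_comm y x] at h2
    have hp : 0 < (2 * s) ^ n := by positivity
    rw [hmean, hmean, ← mul_sub, abs_mul, abs_of_pos (inv_pos.2 hp), inv_mul_le_iff₀ hp,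
      ← hx, ← hy, add_sub_add_left_eq_sub]
    refine (abs_sub _ _).trans ((add_le_add h1 h2).trans (le_of_eq ?_))
    ring
  · have h1 := abs_ballMean_le hm hM hs x
    have h2 := abs_ballMean_le hm hM hs y
    refine (abs_sub _ _).trans ?_
    rw [div_mul_eq_mul_div, le_div_iff₀ hs]
    have h3 : s ≤ n * dist x y := by nlinarith
    nlinarith

/-- A ball mean over a subball of half the radius is close to any approximate mean. -/
lemma abs_ballMean_sub_le {F : (Fin n → ℝ) → ℝ} (hm : Measurable F) {M : ℝ}
    (hM : ∀ x, |F x| ≤ M) {s : ℝ} (hs : 0 < s) {c x : Fin n → ℝ} (hx : x ∈ closedBall c s)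
    {a η : ℝ} (ha : ∫ y, |F y - a| ∂(⟨c, 2 * s, by positivity⟩ : Cube n).unif ≤ η) :
    |ballMean F s x - a| ≤ 2 ^ n * η := by
  let Q : Cube n := ⟨x, s, hs⟩
  let R : Cube n := ⟨c, 2 * s, by positivity⟩
  have hQR : Q.toSet ⊆ R.toSet :=
    closedBall_subset_closedBall' (by have := mem_closedBall.1 hx; linarith)
  have h1 := Q.abs_avg_sub_le (Q.integrable_unif hm fun x _ => hM x) a
  have hint : IntegrableOn (fun y => |F y - a|) R.toSet :=
    Measure.integrableOn_of_bounded measure_closedBall_lt_top.ne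
      (hm.sub_const a).abs.aestronglyMeasurable (M := M + |a|) (ae_of_all _ fun y => by
        rw [Real.norm_eq_abs, abs_abs]
        exact (abs_sub _ _).trans (by gcongr; exact hM y))
  have h2 := Cube.integral_unif_le_of_subset hQR hint fun y => abs_nonneg _
  have h3 : R.half / Q.half = 2 := by simp [R, Q, hs.ne']
  rw [h3] at h2
  exact h1.trans (h2.trans (by gcongr))

/-- Ball means approximate a bounded function of uniformly small mean oscillation, in mean on
large cubes and modulo constants on small ones. -/
lemma approx_ballMean (hn : 0 < n) {F : (Fin n → ℝ) → ℝ} (hm : Measurable F)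
    {M : ℝ} (hM : ∀ x, |F x| ≤ M) {s η : ℝ} (hs : 0 < s)
    (hF : ∀ Q : Cube n, Q.half ≤ 2 * s → ∃ a, ∫ x, |F x - a| ∂Q.unif ≤ η) (Q : Cube n) :
    (∃ a, ∫ x, |F x - ballMean F s x - a| ∂Q.unif ≤ 2 * 4 ^ n * η) ∧
    (s ≤ Q.half → ∫ x, |F x - ballMean F s x| ∂Q.unif ≤ 2 * 4 ^ n * η) := by
  obtain ⟨K, hK⟩ := exists_lipschitzWith_ballMean hn hm hM hs
  have hgm : Measurable (ballMean F s) := hK.continuous.measurable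
  have hgM := abs_ballMean_le hm hM hs
  have hη : 0 ≤ η := by
    obtain ⟨a, ha⟩ := hF ⟨0, s, hs⟩ (by simp; linarith)
    exact (integral_nonneg fun _ => abs_nonneg _).trans ha
  have hFi : ∀ (Q : Cube n) (a : ℝ), Integrable (fun x => |F x - a|) Q.unif := fun Q a =>
    ((Q.integrable_unif hm fun x _ => hM x).sub (integrable_const a)).abs
  have hDi : ∀ (Q : Cube n) (a : ℝ), Integrable (fun x => |F x - ballMean F s x - a|) Q.unif :=
    fun Q a => (((Q.integrable_unif hm fun x _ => hM x).sub
      (Q.integrable_unif hgm fun x _ => hgM x)).sub (integrable_const a)).abs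
  have h4 : (4 : ℝ) ^ n = 2 ^ n * 2 ^ n := by rw [← mul_pow]; norm_num
  have large : s ≤ Q.half → ∫ x, |F x - ballMean F s x| ∂Q.unif ≤ 2 * 4 ^ n * η := by
    intro hsQ
    have := Q.integral_unif_le_of_small (h := fun x => |F x - ballMean F s x|) (M := M + M)
      (η := 2 ^ n * η + 2 ^ n * η)
      (hm.sub hgm).abs (fun _ => abs_nonneg _)
      (fun x => (abs_sub _ _).trans (add_le_add (hM x) (hgM x))) hs hsQ (by positivity) ?_
    · refine this.trans (le_of_eq ?_)
      rw [h4]; ring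
    · intro c
      obtain ⟨a, ha⟩ := hF ⟨c, 2 * s, by positivity⟩ le_rfl
      let P : Cube n := ⟨c, s, hs⟩
      have hint : IntegrableOn (fun y => |F y - a|) (closedBall c (2 * s)) :=
        Measure.integrableOn_of_bounded measure_closedBall_lt_top.ne
          (hm.sub_const a).abs.aestronglyMeasurable (M := M + |a|) (ae_of_all _ fun y => by
            rw [Real.norm_eq_abs, abs_abs]
            exact (abs_sub _ _).trans (by gcongr; exact hM y))
      have h1 := Cube.integral_unif_le_of_subset (Q := P) (T := ⟨c, 2 * s, by positivity⟩)
        (closedBall_subset_closedBall (by simp [P]; linarith)) hint fun y => abs_nonneg _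
      have h3 : 2 * s / P.half = 2 := by simp [P, hs.ne']
      simp only [h3] at h1
      have h5 := P.integral_unif_mono (by simpa using hDi P 0)
        ((hFi P a).add (integrable_const (2 ^ n * η)))
        fun x hx => (abs_sub_le (F x) a (ballMean F s x)).trans
          (add_le_add le_rfl (by
            rw [abs_sub_comm]
            exact abs_ballMean_sub_le hm hM hs hx ha))
      refine h5.trans ?_
      simp only [Pi.add_apply]
      rw [integral_add (hFi P a) (integrable_const _)]
      simp only [integral_const, probReal_univ, one_smul]
      gcongr
      exact h1.trans (by gcongr)
  refine ⟨?_, large⟩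
  rcases le_total s Q.half with hsQ | hsQ
  · exact ⟨0, by simpa using large hsQ⟩
  obtain ⟨a, ha⟩ := hF Q (by linarith)
  obtain ⟨b, hb⟩ := hF ⟨Q.center, 2 * s, by positivity⟩ le_rfl
  refine ⟨a - b, ?_⟩
  have h5 := Q.integral_unif_mono (hDi Q (a - b))
    ((hFi Q a).add (integrable_const (2 ^ n * η)))
    fun x hx => by
      have h6 := abs_ballMean_sub_le hm hM hs (closedBall_subset_closedBall hsQ hx) hb
      have h7 := abs_sub (F x - a) (ballMean F s x - b)
      rw [show F x - a - (ballMean F s x - b) = F x - ballMean F s x - (a - b) by ring] at h7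
      exact h7.trans (add_le_add le_rfl h6)
  refine h5.trans ?_
  simp only [Pi.add_apply]
  rw [integral_add (hFi Q a) (integrable_const _)]
  simp only [integral_const, probReal_univ, one_smul]
  have h8 : η ≤ 4 ^ n * η := le_mul_of_one_le_left hη (one_le_pow₀ (by norm_num))
  have h9 : (2 : ℝ) ^ n * η ≤ 4 ^ n * η := by gcongr; norm_num
  linarith

/-- A logarithmic cutoff near the boundary, of small mean oscillation on every cube. -/
lemma exists_cutoff (Ω : Set (Fin n → ℝ)) {ρ δ : ℝ} (hρ : 0 < ρ) (hδ : 0 < δ) :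
    ∃ φ : (Fin n → ℝ) → ℝ, Measurable φ ∧ (∀ x, 0 ≤ φ x) ∧ (∀ x, φ x ≤ 1) ∧
      (∃ a > 0, ∀ x, φ x ≠ 0 → closedBall x a ⊆ Ω) ∧
      (∀ Q : Cube n, Q.toSet ⊆ Ω → ∃ b, 0 ≤ b ∧ b ≤ 1 ∧ ∫ x, |φ x - b| ∂Q.unif ≤ δ) ∧
      (∀ Q : Cube n, Q.toSet ⊆ Ω → ρ ≤ Q.half → ∫ x, |1 - φ x| ∂Q.unif ≤ δ) := by
  rcases (Ωᶜ).eq_empty_or_nonempty with hemp | hne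
  · refine ⟨fun _ => 1, measurable_const, by simp, by simp, ⟨1, one_pos, ?_⟩, ?_, ?_⟩
    · simp [Set.compl_empty_iff.1 hemp]
    · exact fun Q _ => ⟨1, by simp, le_rfl, by simpa using hδ.le⟩
    · exact fun Q _ _ => by simpa using hδ.le
  obtain ⟨κ, hκ, hκ1, hκδ⟩ : ∃ κ : ℝ, 0 < κ ∧ κ ≤ 1 / 2 ∧ n * κ ≤ δ / 2 := by
    refine ⟨min (1 / 2) (δ / (2 * (n + 1))), by positivity, min_le_left _ _, ?_⟩
    calc n * min (1 / 2) (δ / (2 * (n + 1))) ≤ (n + 1) * (δ / (2 * (n + 1))) := by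
          gcongr
          · linarith
          · exact min_le_right _ _
      _ = δ / 2 := by field_simp
  have hlogκ : 0 < Real.log κ⁻¹ :=
    Real.log_pos ((one_lt_inv₀ hκ).2 (by linarith))
  set L : ℝ := Real.log κ⁻¹ / (δ / 2) with hL
  have hLpos : 0 < L := by positivity
  set ε : ℝ := κ * ρ with hε
  have hεpos : 0 < ε := by positivity
  set a : ℝ := ε * Real.exp (-L) with ha
  have hapos : 0 < a := by positivity
  have hloga : Real.log a = Real.log ε - L := by
    rw [ha, Real.log_mul hεpos.ne' (Real.exp_pos _).ne', Real.log_exp]; ring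
  let d : (Fin n → ℝ) → ℝ := fun x => infDist x Ωᶜ
  let ψ : (Fin n → ℝ) → ℝ := fun x => 1 + (Real.log (max (d x) a) - Real.log ε) / L
  let φ : (Fin n → ℝ) → ℝ := fun x => min 1 (ψ x)
  have hdm : Measurable d := (continuous_infDist_pt _).measurable
  have hφm : Measurable φ :=
    measurable_const.min (measurable_const.add
      (((Real.measurable_log.comp (hdm.max measurable_const)).sub_const _).div_const _))
  have hψ0 : ∀ x, 0 ≤ ψ x := by
    intro x
    have h1 : Real.log a ≤ Real.log (max (d x) a) := Real.log_le_log hapos (le_max_right _ _)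
    have h2 : -1 ≤ (Real.log (max (d x) a) - Real.log ε) / L := by
      rw [le_div_iff₀ hLpos]; linarith
    simp only [ψ]; linarith
  have hφ0 : ∀ x, 0 ≤ φ x := fun x => le_min zero_le_one (hψ0 x)
  have hφ1 : ∀ x, φ x ≤ 1 := fun x => min_le_left _ _
  have hball : ∀ x t, closedBall x t ⊆ Ω → t ≤ d x := by
    intro x t hxt
    refine (le_infDist hne).2 fun y hy => ?_
    by_contra hlt
    exact hy (hxt (mem_closedBall.2 (by rw [dist_comm]; linarith)))
  -- On the shrunk cube the distance to the complement is comparable to that of the center.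
  have hinner : ∀ Q : Cube n, Q.toSet ⊆ Ω →
      ∀ x ∈ closedBall Q.center ((1 - κ) * Q.half),
        κ * d Q.center ≤ d x ∧ d x ≤ κ⁻¹ * d Q.center := by
    intro Q hQ x hx
    have h1 := hball _ _ hQ
    have h2 := mem_closedBall.1 hx
    have h3 : d Q.center ≤ d x + dist Q.center x := infDist_le_infDist_add_dist
    have h4 : d x ≤ d Q.center + dist x Q.center := infDist_le_infDist_add_dist
    rw [dist_comm] at h3
    have hp := Q.half_pos
    have h5 : (2 : ℝ) ≤ κ⁻¹ := by
      rw [le_inv_comm₀ two_pos hκ]; linarith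
    constructor <;> nlinarith
  refine ⟨φ, hφm, hφ0, hφ1, ⟨a / 2, by positivity, ?_⟩, ?_, ?_⟩
  · intro x hx y hy
    by_contra hyΩ
    have h1 : d x ≤ dist x y := infDist_le_dist_of_mem hyΩ
    have h2 := mem_closedBall'.1 hy
    have h3 : max (d x) a = a := max_eq_right (by linarith)
    refine hx ?_
    have : ψ x = 0 := by
      simp only [ψ, h3, hloga]
      field_simp
      ring
    simp [φ, this]
  · intro Q hQ
    refine ⟨φ Q.center, hφ0 _, hφ1 _, ?_⟩
    have := Q.integral_unif_le_of_shell (h := fun x => |φ x - φ Q.center|)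
      (hφm.sub_const _).abs hκ.le (by linarith) (half_pos hδ).le (fun _ => abs_nonneg _)
      (fun x => abs_le.2 ⟨by linarith [hφ0 x, hφ1 Q.center], by linarith [hφ1 x, hφ0 Q.center]⟩)
      ?_
    · linarith
    · intro x hx
      obtain ⟨h1, h2⟩ := hinner Q hQ x hx
      have hκi : 1 ≤ κ⁻¹ := (one_le_inv₀ hκ).2 (by linarith)
      have hm1 : 0 < max (d x) a := lt_max_of_lt_right hapos
      have hm2 : 0 < max (d Q.center) a := lt_max_of_lt_right hapos
      have h3 : max (d x) a ≤ κ⁻¹ * max (d Q.center) a := by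
        refine max_le (h2.trans (by gcongr; exact le_max_left _ _)) ?_
        calc a ≤ max (d Q.center) a := le_max_right _ _
          _ ≤ _ := le_mul_of_one_le_left hm2.le hκi
      have h4 : max (d Q.center) a ≤ κ⁻¹ * max (d x) a := by
        refine max_le ?_ ?_
        · calc d Q.center ≤ κ⁻¹ * d x := by rwa [le_inv_mul_iff₀ hκ]
            _ ≤ _ := by gcongr; exact le_max_left _ _
        · calc a ≤ max (d x) a := le_max_right _ _
            _ ≤ _ := le_mul_of_one_le_left hm1.le hκi
      have h5 := Real.log_le_log hm1 h3
      have h6 := Real.log_le_log hm2 h4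
      rw [Real.log_mul (by positivity) hm2.ne'] at h5
      rw [Real.log_mul (by positivity) hm1.ne'] at h6
      calc |φ x - φ Q.center| ≤ |ψ x - ψ Q.center| := by
            have := abs_min_sub_min_le_max 1 (ψ x) 1 (ψ Q.center)
            simpa using this
        _ = |Real.log (max (d x) a) - Real.log (max (d Q.center) a)| / L := by
            rw [show ψ x - ψ Q.center =
              (Real.log (max (d x) a) - Real.log (max (d Q.center) a)) / L by simp only [ψ]; ring,
              abs_div, abs_of_pos hLpos]
        _ ≤ Real.log κ⁻¹ / L := by
            gcongr
            exact abs_le.2 ⟨by linarith, by linarith⟩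
        _ = δ / 2 := by rw [hL, div_div_cancel₀ hlogκ.ne']
  · intro Q hQ hρQ
    have := Q.integral_unif_le_of_shell (h := fun x => |1 - φ x|)
      (measurable_const.sub hφm).abs hκ.le (by linarith) (half_pos hδ).le (fun _ => abs_nonneg _)
      (fun x => abs_le.2 ⟨by linarith [hφ0 x, hφ1 x], by linarith [hφ1 x, hφ0 x]⟩) ?_
    · linarith
    · intro x hx
      have h1 := (hinner Q hQ x hx).1
      have h2 := hball _ _ hQ
      have h3 : ε ≤ max (d x) a := by
        refine le_max_of_le_left (le_trans ?_ h1)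
        exact mul_le_mul_of_nonneg_left (hρQ.trans h2) hκ.le
      have h4 := Real.log_le_log hεpos h3
      have h5 : φ x = 1 := by
        refine min_eq_left ?_
        have : 0 ≤ (Real.log (max (d x) a) - Real.log ε) / L :=
          div_nonneg (by linarith) hLpos.le
        simp only [ψ]; linarith
      simp only [h5, sub_self, abs_zero]
      positivity

/-- Multiplying a bounded function by a factor with values in `[0, 1]` keeps small deviations. -/
lemma Cube.integral_abs_mul_sub_le (Q : Cube n) {f φ : (Fin n → ℝ) → ℝ} (hf : Measurable f)
    (hφ : Measurable φ) {M : ℝ} (hM : ∀ x ∈ Q.toSet, |f x| ≤ M) (hφ0 : ∀ x, 0 ≤ φ x)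
    (hφ1 : ∀ x, φ x ≤ 1) {b η δ : ℝ} (hη : Q.osc f ≤ η)
    (hδ : ∫ x, |φ x - b| ∂Q.unif ≤ δ) :
    ∫ x, |φ x * f x - b * Q.avg f| ∂Q.unif ≤ η + M * δ := by
  have hM0 : 0 ≤ M := (abs_nonneg _).trans (hM Q.center (mem_closedBall_self Q.half_pos.le))
  have hfi : Integrable f Q.unif := Q.integrable_unif hf hM
  have hφi : Integrable φ Q.unif := Q.integrable_unif hφ (M := 1) fun x _ =>
    abs_le.2 ⟨by linarith [hφ0 x], hφ1 x⟩
  have hmi : Integrable (fun x => φ x * f x) Q.unif :=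
    Q.integrable_unif (hφ.mul hf) (M := M) fun x hx => by
      rw [abs_mul, abs_of_nonneg (hφ0 x)]
      calc φ x * |f x| ≤ 1 * M := by
            gcongr
            · exact hφ1 x
            · exact hM x hx
        _ = M := one_mul M
  have havg : |Q.avg f| ≤ M := by
    have h1 := Q.abs_avg_sub_le hfi 0
    simp only [sub_zero] at h1
    exact h1.trans (Q.integral_unif_le_const hfi.abs hM)
  have i1 : Integrable (fun x => |f x - Q.avg f|) Q.unif := (hfi.sub (integrable_const _)).abs
  have i2 : Integrable (fun x => M * |φ x - b|) Q.unif :=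
    ((hφi.sub (integrable_const b)).abs).const_mul M
  calc ∫ x, |φ x * f x - b * Q.avg f| ∂Q.unif
      ≤ ∫ x, (|f x - Q.avg f| + M * |φ x - b|) ∂Q.unif := by
        refine Q.integral_unif_mono (hmi.sub (integrable_const _)).abs (i1.add i2) fun x _ => ?_
        rw [show φ x * f x - b * Q.avg f = φ x * (f x - Q.avg f) + Q.avg f * (φ x - b) by ring]
        refine (abs_add_le _ _).trans (add_le_add ?_ ?_)
        · rw [abs_mul, abs_of_nonneg (hφ0 x)]
          exact mul_le_of_le_one_left (abs_nonneg _) (hφ1 x)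
        · rw [abs_mul]
          gcongr
    _ = Q.osc f + M * ∫ x, |φ x - b| ∂Q.unif := by
        rw [integral_add i1 i2, integral_const_mul]
        rfl
    _ ≤ η + M * δ := by gcongr

/-- Bounded functions have oscillation at most the modulus of mean oscillation. -/
lemma Cube.osc_le_omegaOn {Ω : Set (Fin n → ℝ)} {f : (Fin n → ℝ) → ℝ} (hf : Measurable f)
    {M : ℝ} (hM : ∀ x ∈ Ω, |f x| ≤ M) {t : ℝ} {Q : Cube n} (hQ : Q.toSet ⊆ Ω)
    (ht : Q.side < t) : Q.osc f ≤ omegaOn Ω f t := by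
  refine le_csSup ⟨2 * M, ?_⟩ ⟨Q, hQ, ht, rfl⟩
  rintro _ ⟨R, hR, -, rfl⟩
  have hi : Integrable f R.unif := R.integrable_unif hf fun x hx => hM x (hR hx)
  refine (R.osc_le hi 0).trans ?_
  simp only [sub_zero]
  gcongr
  exact R.integral_unif_le_const hi.abs fun x hx => hM x (hR hx)

lemma bmoNorm_nonneg (Ω : Set (Fin n → ℝ)) (lam : ℝ) (h : (Fin n → ℝ) → ℝ) :
    0 ≤ bmoNorm Ω lam h := by
  refine add_nonneg (Real.sSup_nonneg ?_) (Real.sSup_nonneg ?_)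
  · rintro _ ⟨Q, -, -, rfl⟩
    exact integral_nonneg fun _ => abs_nonneg _
  · rintro _ ⟨Q, -, -, rfl⟩
    exact integral_nonneg fun _ => abs_nonneg _

lemma bmoNorm_le {Ω : Set (Fin n → ℝ)} {lam τ : ℝ} {h : (Fin n → ℝ) → ℝ} (hτ : 0 ≤ τ)
    (hi : ∀ Q : Cube n, Q.toSet ⊆ Ω → Integrable h Q.unif)
    (hsmall : ∀ Q : Cube n, Q.toSet ⊆ Ω → ∃ a, ∫ x, |h x - a| ∂Q.unif ≤ τ)
    (hlarge : ∀ Q : Cube n, Q.toSet ⊆ Ω → lam ≤ Q.side → ∫ x, |h x| ∂Q.unif ≤ τ) :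
    bmoNorm Ω lam h ≤ 3 * τ := by
  have h1 : omegaOn Ω h lam ≤ 2 * τ := by
    refine Real.sSup_le ?_ (by positivity)
    rintro _ ⟨Q, hQ, -, rfl⟩
    obtain ⟨a, ha⟩ := hsmall Q hQ
    exact (Q.osc_le (hi Q hQ) a).trans (by gcongr)
  have h2 : bigAvgSup Ω lam h ≤ τ := by
    refine Real.sSup_le ?_ hτ
    rintro _ ⟨Q, hQ, hl, rfl⟩
    exact hlarge Q hQ hl
  rw [bmoNorm]
  linarith

/-- Approximation up to a prescribed error. -/
lemma exists_lipschitz_bmoNorm_sub_le (hn : 0 < n) {Ω : Set (Fin n → ℝ)} (hΩ : IsOpen Ω)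
    {lam : ℝ} (hlam : 0 < lam) {f : (Fin n → ℝ) → ℝ} (hmeas : Measurable f)
    (hbdd : BoundedOn Ω f) (hvmo : VanishSmallOsc Ω f) {τ : ℝ} (hτ : 0 < τ) :
    ∃ g : (Fin n → ℝ) → ℝ, (BoundedOn Ω g ∧ LipschitzOn Ω g ∧ SuppAway Ω g) ∧
      bmoNorm Ω lam (f - g) ≤ τ := by
  obtain ⟨M, hMpos, hM⟩ : ∃ M : ℝ, 0 < M ∧ ∀ x ∈ Ω, |f x| ≤ M := by
    obtain ⟨M, hM⟩ := hbdd
    exact ⟨max M 1, by positivity, fun x hx => (hM x hx).trans (le_max_left _ _)⟩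
  set C : ℝ := 2 * 4 ^ n + 1 with hC
  have hCpos : 0 < C := by positivity
  set η : ℝ := τ / (3 * C) / 2 with hη
  have hηpos : 0 < η := by positivity
  set δ : ℝ := η / M with hδ
  have hδpos : 0 < δ := by positivity
  have hMδ : M * δ = η := by rw [hδ]; field_simp
  obtain ⟨t, htpos, ht⟩ : ∃ t > 0, omegaOn Ω f t < η := by
    have := (hvmo.eventually (gt_mem_nhds hηpos)).and self_mem_nhdsWithin
    obtain ⟨t, ht, htpos⟩ := this.exists
    exact ⟨t, htpos, ht⟩
  have hosc : ∀ Q : Cube n, Q.toSet ⊆ Ω → Q.side < t → Q.osc f ≤ η := fun Q hQ hs =>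
    (Cube.osc_le_omegaOn hmeas hM hQ hs).trans ht.le
  set ρ : ℝ := min t lam / 4 with hρ
  have hρpos : 0 < ρ := by positivity
  have hρt : ρ ≤ t / 4 := by rw [hρ]; gcongr; exact min_le_left _ _
  have hρl : ρ ≤ lam / 4 := by rw [hρ]; gcongr; exact min_le_right _ _
  obtain ⟨φ, hφm, hφ0, hφ1, ⟨a, hapos, hφa⟩, hφosc, hφlarge⟩ := exists_cutoff Ω hρpos hδpos
  set F : (Fin n → ℝ) → ℝ := fun x => φ x * f x with hF
  have hφΩ : ∀ x, φ x ≠ 0 → x ∈ Ω := fun x hx => hφa x hx (mem_closedBall_self hapos.le)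
  have hFm : Measurable F := hφm.mul hmeas
  have hFM : ∀ x, |F x| ≤ M := by
    intro x
    by_cases hx : φ x = 0
    · simp [hF, hx, hMpos.le]
    · simp only [hF, abs_mul, abs_of_nonneg (hφ0 x)]
      calc φ x * |f x| ≤ 1 * M := by
            gcongr
            · exact hφ1 x
            · exact hM x (hφΩ x hx)
        _ = M := one_mul M
  set s : ℝ := min (a / 4) (ρ / 2) with hs
  have hspos : 0 < s := by positivity
  have hsa : s ≤ a / 4 := min_le_left _ _
  have hsρ : s ≤ ρ / 2 := min_le_right _ _
  have hFosc : ∀ Q : Cube n, Q.half ≤ 2 * s → ∃ b, ∫ x, |F x - b| ∂Q.unif ≤ 2 * η := by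
    intro Q hQs
    by_cases hz : ∃ x ∈ Q.toSet, φ x ≠ 0
    · obtain ⟨x, hxQ, hx⟩ := hz
      have hQ : Q.toSet ⊆ Ω := by
        refine (closedBall_subset_closedBall' ?_).trans (hφa x hx)
        have := mem_closedBall'.1 hxQ
        linarith
      obtain ⟨b, -, -, hb⟩ := hφosc Q hQ
      have := Q.integral_abs_mul_sub_le hmeas hφm (fun x hx => hM x (hQ hx)) hφ0 hφ1
        (hosc Q hQ (by rw [Cube.side]; linarith)) hb
      exact ⟨b * Q.avg f, this.trans (by linarith)⟩
    · push Not at hz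
      refine ⟨0, ?_⟩
      rw [integral_congr_ae (g := fun _ => 0) (Q.ae_unif fun x hx => by simp [hF, hz x hx])]
      simp [hηpos.le]
  obtain ⟨K, hK⟩ := exists_lipschitzWith_ballMean hn hFm hFM hspos
  have hgM := abs_ballMean_le hFm hFM hspos
  refine ⟨ballMean F s, ⟨⟨M, fun x _ => hgM x⟩, ⟨K, hK.lipschitzOnWith⟩, a / 2,
    by positivity, ?_⟩, ?_⟩
  · intro x hx y hy
    obtain ⟨z, hz, hzφ⟩ : ∃ z ∈ closedBall x s, φ z ≠ 0 := by
      by_contra! hzero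
      refine hx ?_
      rw [ballMean, setAverage_eq,
        setIntegral_eq_zero_of_forall_eq_zero fun z hz => by simp [hF, hzero z hz], smul_zero]
    have hyΩ : y ∉ Ω := fun h => (hΩ.frontier_eq ▸ hy).2 h
    have h1 : a < dist y z := by
      by_contra! hle
      exact hyΩ (hφa z hzφ (mem_closedBall.2 hle))
    have h2 := mem_closedBall.1 hz
    have := dist_triangle y x z
    rw [dist_comm y x, dist_comm x z] at this
    linarith
  have hgm : Measurable (ballMean F s) := hK.continuous.measurable
  have hfi : ∀ Q : Cube n, Q.toSet ⊆ Ω → Integrable f Q.unif := fun Q hQ =>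
    Q.integrable_unif hmeas fun x hx => hM x (hQ hx)
  have hFi : ∀ Q : Cube n, Integrable F Q.unif := fun Q =>
    Q.integrable_unif hFm fun x _ => hFM x
  have hgi : ∀ Q : Cube n, Integrable (ballMean F s) Q.unif := fun Q =>
    Q.integrable_unif hgm fun x _ => hgM x
  have hadd : ∀ Q : Cube n, Q.toSet ⊆ Ω → ∀ b c p q : ℝ, ∫ x, |f x - F x - b| ∂Q.unif ≤ p →
      ∫ x, |F x - ballMean F s x - c| ∂Q.unif ≤ q →
      ∫ x, |(f - ballMean F s) x - (b + c)| ∂Q.unif ≤ p + q := by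
    intro Q hQ b c p q hp hq
    have i1 : Integrable (fun x => |f x - F x - b|) Q.unif :=
      (((hfi Q hQ).sub (hFi Q)).sub (integrable_const b)).abs
    have i2 : Integrable (fun x => |F x - ballMean F s x - c|) Q.unif :=
      (((hFi Q).sub (hgi Q)).sub (integrable_const c)).abs
    have h1 := Q.integral_unif_mono (((hfi Q hQ).sub (hgi Q)).sub (integrable_const (b + c))).abs
      (i1.add i2) fun x _ => by
        have := abs_add_le (f x - F x - b) (F x - ballMean F s x - c)
        rw [show f x - F x - b + (F x - ballMean F s x - c) =
          f x - ballMean F s x - (b + c) by ring] at this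
        exact this
    simp only [Pi.add_apply] at h1
    rw [integral_add i1 i2] at h1
    exact h1.trans (add_le_add hp hq)
  have happ := approx_ballMean hn hFm hFM hspos hFosc
  have hlarge : ∀ Q : Cube n, Q.toSet ⊆ Ω → ρ ≤ Q.half → ∫ x, |f x - F x| ∂Q.unif ≤ 2 * η := by
    intro Q hQ hρQ
    have i1 : Integrable (fun x => M * |1 - φ x|) Q.unif :=
      (Q.integrable_unif (measurable_const.sub hφm).abs (M := 1) fun x _ => by
        rw [abs_abs]
        change |1 - φ x| ≤ 1
        exact abs_le.2 ⟨by linarith [hφ1 x], by linarith [hφ0 x]⟩).const_mul M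
    have h1 := Q.integral_unif_mono ((hfi Q hQ).sub (hFi Q)).abs i1 fun x hx => by
      rw [Pi.sub_apply, show f x - F x = f x * (1 - φ x) by simp only [hF]; ring, abs_mul]
      gcongr
      exact hM x (hQ hx)
    rw [integral_const_mul] at h1
    have h2 := mul_le_mul_of_nonneg_left (hφlarge Q hQ hρQ) hMpos.le
    refine h1.trans (h2.trans ?_)
    linarith
  have hsmall : ∀ Q : Cube n, Q.toSet ⊆ Ω → ∃ b, ∫ x, |f x - F x - b| ∂Q.unif ≤ 2 * η := by
    intro Q hQ
    rcases le_or_gt ρ Q.half with hρQ | hρQ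
    · exact ⟨0, by simpa using hlarge Q hQ hρQ⟩
    obtain ⟨b, -, -, hb⟩ := hφosc Q hQ
    have h1 := Q.integral_abs_mul_sub_le (φ := fun x => 1 - φ x) (b := 1 - b) (δ := δ) hmeas
      (measurable_const.sub hφm) (fun x hx => hM x (hQ hx)) (fun x => by linarith [hφ1 x])
      (fun x => by linarith [hφ0 x]) (hosc Q hQ (by rw [Cube.side]; linarith)) (by
        simpa only [sub_sub_sub_cancel_left, abs_sub_comm b] using hb)
    refine ⟨(1 - b) * Q.avg f, ?_⟩
    have h2 : ∀ x, f x - F x = (1 - φ x) * f x := fun x => by simp only [hF]; ring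
    simp only [h2]
    linarith
  have hsum : 2 * η + 2 * 4 ^ n * (2 * η) = τ / 3 := by
    have : 2 * η + 2 * 4 ^ n * (2 * η) = 2 * C * η := by rw [hC]; ring
    rw [this, hη]
    field_simp
  have := bmoNorm_le (lam := lam) (τ := τ / 3) (h := f - ballMean F s) (Ω := Ω) (by positivity)
    (fun Q hQ => (hfi Q hQ).sub (hgi Q)) ?_ ?_
  · linarith
  · intro Q hQ
    obtain ⟨b, hb⟩ := hsmall Q hQ
    obtain ⟨c, hc⟩ := (happ Q).1
    exact ⟨b + c, hsum ▸ hadd Q hQ b c _ _ hb hc⟩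
  · intro Q hQ hl
    rw [Cube.side] at hl
    have := hadd Q hQ 0 0 _ _ (by simpa using hlarge Q hQ (by linarith))
      (by simpa using (happ Q).2 (by linarith))
    rw [hsum] at this
    simpa using this

/-- Lemma: a bounded measurable function on a domain Ω with vanishing mean oscillation can
be approximated in bmo_λ(Ω) by bounded Lipschitz functions supported away from ∂Ω. -/
theorem stmt16 {n : ℕ} (hn : 0 < n) (Ω : Set (Fin n → ℝ)) (hΩ : IsRealDomain Ω)
    (lam : ℝ) (hlam : 0 < lam) (f : (Fin n → ℝ) → ℝ)
    (hmeas : Measurable f) (hbdd : BoundedOn Ω f)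
    (hvmo : VanishSmallOsc Ω f) :
    ∃ g : ℕ → (Fin n → ℝ) → ℝ,
      (∀ j, BoundedOn Ω (g j) ∧ LipschitzOn Ω (g j) ∧ SuppAway Ω (g j)) ∧
      Tendsto (fun j => bmoNorm Ω lam (f - g j)) atTop (nhds 0) := by
  choose g hg hle using fun j : ℕ => exists_lipschitz_bmoNorm_sub_le hn hΩ.1 hlam hmeas hbdd hvmo
    (Nat.one_div_pos_of_nat (α := ℝ) (n := j))
  exact ⟨g, hg, squeeze_zero (fun _ => bmoNorm_nonneg _ _ _) hle
    tendsto_one_div_add_atTop_nhds_zero_nat⟩
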